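/- arXiv:math/0512354 — 3 statements merged into one kernel-verified Lean document; each statement's English description precedes it below -/
import Mathlib

section
/- Let K be a field and let L and L′ be nonabelian Lie algebras over K of the same finite dimension n ≥ 2, each satisfying the property that for all u, v the bracket [u,v] lies in the linear span of u and v. Then L and L′ are isomorphic as Lie algebras. (Thus, up to isomorphism, over any field there is exactly one nonabelian Lie algebra of each dimension ≥ 2 with this property.) -/
open Module

section BracketInSpan

variable {K L L' : Type*} [Field K] [LieRing L] [LieAlgebra K L] [LieRing L'] [LieAlgebra K L']

/-- If every bracket lies in the span of its arguments, then `ad u` acts as a scalar modulo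
the line through `u`. -/
lemma exists_lie_sub_smul_mem_span_singleton
    (hspan : ∀ u v : L, ⁅u, v⁆ ∈ Submodule.span K {u, v}) (u : L) :
    ∃ c : K, (u = 0 → c = 0) ∧ ∀ v : L, ⁅u, v⁆ - c • v ∈ Submodule.span K {u} := by
  by_cases hu : u = 0
  · exact ⟨0, by simp, by simp [hu]⟩
  let f : (L ⧸ Submodule.span K {u}) →ₗ[K] (L ⧸ Submodule.span K {u}) :=
    Submodule.mapQ _ _ (LieAlgebra.ad K L u : L →ₗ[K] L) <| by
      rw [Submodule.span_singleton_le_iff_mem]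
      simp
  obtain ⟨c, hc⟩ : ∃ c : K, f = c • 1 := by
    refine LinearMap.exists_eq_smul_id_of_forall_notLinearIndependent fun q h ↦ ?_
    obtain ⟨v, rfl⟩ := Submodule.Quotient.mk_surjective _ q
    obtain ⟨a, b, hab⟩ := Submodule.mem_span_pair.mp (hspan u v)
    rw [LinearIndependent.pair_iff] at h
    have := h b (-1) <| by
      rw [Submodule.mapQ_apply, ← Submodule.Quotient.mk_smul, ← Submodule.Quotient.mk_smul,
        ← Submodule.Quotient.mk_add, Submodule.Quotient.mk_eq_zero, LieAlgebra.ad_apply, ← hab,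
        Submodule.mem_span_singleton]
      exact ⟨-a, by module⟩
    simp at this
  refine ⟨c, fun h ↦ absurd h hu, fun v ↦ ?_⟩
  rw [← Submodule.Quotient.mk_eq_zero, Submodule.Quotient.mk_sub, Submodule.Quotient.mk_smul,
    sub_eq_zero]
  exact LinearMap.congr_fun hc (Submodule.Quotient.mk v)

/-- If every bracket lies in the span of its arguments, then the bracket is determined by a
linear form. -/
lemma exists_dual_lie_eq_smul_sub_smul (h2 : 2 ≤ finrank K L)
    (hspan : ∀ u v : L, ⁅u, v⁆ ∈ Submodule.span K {u, v}) :
    ∃ φ : Dual K L, ∀ u v : L, ⁅u, v⁆ = φ u • v - φ v • u := by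
  choose φ hφ₀ hφ using exists_lie_sub_smul_mem_span_singleton (K := K) hspan
  have hindep (u v : L) (h : LinearIndependent K ![u, v]) : ⁅u, v⁆ = φ u • v - φ v • u := by
    obtain ⟨a, ha⟩ := Submodule.mem_span_singleton.mp (hφ u v)
    obtain ⟨b, hb⟩ := Submodule.mem_span_singleton.mp (hφ v u)
    rw [← lie_skew] at hb
    have key : (a + φ v) • u + (b + φ u) • v = 0 := by
      linear_combination (norm := module) ha + hb
    have := (LinearIndependent.pair_iff.mp h _ _ key).1
    rw [eq_neg_of_add_eq_zero_left this] at ha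
    linear_combination (norm := module) -ha
  have hlie (u v : L) : ⁅u, v⁆ = φ u • v - φ v • u := by
    by_cases hu : u = 0
    · simp [hu, hφ₀ 0 rfl]
    by_cases h : LinearIndependent K ![u, v]
    · exact hindep u v h
    obtain ⟨c, rfl⟩ : ∃ c : K, c • u = v := by
      simpa [LinearIndependent.pair_iff' hu] using h
    by_cases hc : c = 0
    · simp [hc, hφ₀ 0 rfl]
    obtain ⟨w, hw⟩ := exists_linearIndependent_pair_of_one_lt_finrank (R := K) h2 hu
    have hw' : LinearIndependent K ![c • u, w] := by
      rw [LinearIndependent.pair_iff] at hw ⊢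
      intro s t hst
      have := hw (s * c) t (by rw [mul_smul, hst])
      simpa [hc] using this
    have h₁ := hindep _ _ hw
    have h₂ := hindep _ _ hw'
    rw [smul_lie, h₁] at h₂
    have hw₀ : w ≠ 0 := hw.ne_zero 1
    have : (φ (c • u) - c * φ u) • w = 0 := by
      linear_combination (norm := module) -h₂
    have := sub_eq_zero.mp ((smul_eq_zero.mp this).resolve_right hw₀)
    rw [this, lie_smul, lie_self]
    module
  have : Nontrivial L := nontrivial_of_finrank_pos (R := K) (by omega)
  obtain ⟨w, hw⟩ := exists_ne (0 : L)
  refine ⟨{ toFun := φ, map_add' := fun u v ↦ ?_, map_smul' := fun c u ↦ ?_ }, hlie⟩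
  · have h := add_lie u v w
    rw [hlie, hlie u, hlie v] at h
    have : (φ (u + v) - (φ u + φ v)) • w = 0 := by linear_combination (norm := module) h
    exact sub_eq_zero.mp ((smul_eq_zero.mp this).resolve_right hw)
  · have h := smul_lie c u w
    rw [hlie, hlie u] at h
    have : (φ (c • u) - c * φ u) • w = 0 := by linear_combination (norm := module) h
    exact sub_eq_zero.mp ((smul_eq_zero.mp this).resolve_right hw)

end BracketInSpan

section Dual

variable {K V W : Type*} [Field K] [AddCommGroup V] [Module K V] [AddCommGroup W] [Module K W]

/-- A nonzero linear form splits the space as the product of its kernel and the field. -/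
lemma Module.Dual.exists_linearEquiv_prod_ker {φ : Dual K V} (hφ : φ ≠ 0) :
    ∃ e : V ≃ₗ[K] K × LinearMap.ker φ, ∀ v, (e v).1 = φ v := by
  obtain ⟨g, hg⟩ := (LinearMap.ker φ).subtype.exists_leftInverse_of_injective
    (LinearMap.ker φ).ker_subtype
  have hg' : ∀ x : LinearMap.ker φ, g x = x := fun x ↦ LinearMap.congr_fun hg x
  exact ⟨φ.equivProdOfSurjectiveOfIsCompl g (range_eq_top_of_ne_zero hφ)
    (LinearMap.range_eq_top.mpr fun x ↦ ⟨x, hg' x⟩) (LinearMap.isCompl_of_proj hg'), fun _ ↦ rfl⟩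

/-- Nonzero linear forms on spaces of equal finite dimension are related by a linear
equivalence. -/
lemma Module.Dual.exists_linearEquiv_apply_eq [FiniteDimensional K V] [FiniteDimensional K W]
    (hdim : finrank K V = finrank K W) {φ : Dual K V} {ψ : Dual K W} (hφ : φ ≠ 0) (hψ : ψ ≠ 0) :
    ∃ e : V ≃ₗ[K] W, ∀ v, ψ (e v) = φ v := by
  obtain ⟨e₁, he₁⟩ := exists_linearEquiv_prod_ker hφ
  obtain ⟨e₂, he₂⟩ := exists_linearEquiv_prod_ker hψ
  have h₁ := finrank_ker_add_one_of_ne_zero hφ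
  have h₂ := finrank_ker_add_one_of_ne_zero hψ
  let e := LinearEquiv.ofFinrankEq (R := K) (LinearMap.ker φ) (LinearMap.ker ψ) (by omega)
  exact ⟨e₁ ≪≫ₗ (LinearEquiv.refl K K).prodCongr e ≪≫ₗ e₂.symm, fun v ↦ by simp [← he₂, he₁]⟩

end Dual


/-- Over any field `K`, two nonabelian Lie algebras of the same finite
dimension `n ≥ 2`, each with the property that every bracket `⁅u, v⁆` lies in the span of
`u` and `v`, are isomorphic: up to isomorphism there is exactly one such Lie algebra in
each dimension `≥ 2`. -/
theorem nonabelian_bracket_in_span_unique_up_to_iso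
    (K : Type*) [Field K] (L L' : Type*) [LieRing L] [LieAlgebra K L]
    [LieRing L'] [LieAlgebra K L']
    [FiniteDimensional K L] [FiniteDimensional K L']
    (hdim : Module.finrank K L = Module.finrank K L')
    (h2 : 2 ≤ Module.finrank K L)
    (hnonab : ¬ ∀ u v : L, ⁅u, v⁆ = 0)
    (hnonab' : ¬ ∀ u v : L', ⁅u, v⁆ = 0)
    (hspan : ∀ u v : L, ⁅u, v⁆ ∈ Submodule.span K {u, v})
    (hspan' : ∀ u v : L', ⁅u, v⁆ ∈ Submodule.span K {u, v}) :
    Nonempty (L ≃ₗ⁅K⁆ L') := by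
  obtain ⟨φ, hφ⟩ := exists_dual_lie_eq_smul_sub_smul h2 hspan
  obtain ⟨ψ, hψ⟩ := exists_dual_lie_eq_smul_sub_smul (hdim ▸ h2) hspan'
  have hφ₀ : φ ≠ 0 := by
    rintro rfl
    exact hnonab fun u v ↦ by simp [hφ]
  have hψ₀ : ψ ≠ 0 := by
    rintro rfl
    exact hnonab' fun u v ↦ by simp [hψ]
  obtain ⟨e, he⟩ := Module.Dual.exists_linearEquiv_apply_eq hdim hφ₀ hψ₀
  exact ⟨{ e with map_lie' := fun {u v} ↦ by simp [hφ, hψ, he] }⟩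
end

section
/- If L is a complex Lie algebra of dimension 4, then its derived subalgebra [L,L] has dimension at most 3. -/
namespace LieAlgebra

variable {K L : Type*} [Field K] [LieRing L] [LieAlgebra K L]

/-- If `I` and a family `v` span `L`, the derived subalgebra lies in every submodule that contains
`⁅I, L⁆` and the brackets of members of `v`. -/
lemma derivedSeries_one_le_of_sup_span_eq_top {ι : Type*} {I J : Submodule K L} {v : ι → L}
    (hspan : I ⊔ Submodule.span K (Set.range v) = ⊤)
    (hI : ∀ x ∈ I, ∀ y : L, ⁅x, y⁆ ∈ J) (hv : ∀ i j, ⁅v i, v j⁆ ∈ J) :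
    (derivedSeries K L 1).toSubmodule ≤ J := by
  have hI' : ∀ x ∈ I, ∀ y : L, ⁅y, x⁆ ∈ J := fun x hx y ↦ by
    rw [← lie_skew]
    exact J.neg_mem (hI x hx y)
  have hspan' : ∀ x ∈ Submodule.span K (Set.range v), ∀ y ∈ Submodule.span K (Set.range v),
      ⁅x, y⁆ ∈ J := by
    intro x hx y hy
    induction hx, hy using Submodule.span_induction₂ with
    | mem_mem x y hx hy =>
      obtain ⟨i, rfl⟩ := hx
      obtain ⟨j, rfl⟩ := hy
      exact hv i j
    | zero_left y hy => simp
    | zero_right x hx => simp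
    | add_left x y z _ _ _ h₁ h₂ => rw [add_lie]; exact J.add_mem h₁ h₂
    | add_right x y z _ _ _ h₁ h₂ => rw [lie_add]; exact J.add_mem h₁ h₂
    | smul_left r x y _ _ h => rw [smul_lie]; exact J.smul_mem r h
    | smul_right r x y _ _ h => rw [lie_smul]; exact J.smul_mem r h
  have key := coe_derivedSeries_one_eq K L
  simp only [LieIdeal.toLieSubalgebra_toSubmodule] at key
  rw [key, Submodule.span_le]
  rintro _ ⟨x, y, rfl⟩
  obtain ⟨a, ha, b, hb, rfl⟩ := Submodule.mem_sup.mp (hspan ▸ Submodule.mem_top : x ∈ I ⊔ _)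
  obtain ⟨c, hc, d, hd, rfl⟩ := Submodule.mem_sup.mp (hspan ▸ Submodule.mem_top : y ∈ I ⊔ _)
  rw [SetLike.mem_coe, add_lie, lie_add b]
  exact J.add_mem (hI a ha _) (J.add_mem (hI' c hc _) (hspan' b hb d hd))

/-- A submodule of codimension `n` is complemented by the span of `n` vectors. -/
lemma _root_.Submodule.exists_sup_span_range_eq_top {V : Type*} [AddCommGroup V] [Module K V]
    [FiniteDimensional K V] (I : Submodule K V) {n : ℕ}
    (h : Module.finrank K I + n = Module.finrank K V) :
    ∃ v : Fin n → V, I ⊔ Submodule.span K (Set.range v) = ⊤ := by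
  obtain ⟨C, hC⟩ := I.exists_isCompl
  have hn : Module.finrank K C = n := by
    have := Submodule.finrank_add_eq_of_isCompl hC
    omega
  let b := Module.finBasisOfFinrankEq K C hn
  refine ⟨fun i ↦ (b i : V), ?_⟩
  have : Submodule.span K (Set.range fun i ↦ (b i : V)) = C := by
    have := congrArg (Submodule.map C.subtype) b.span_eq
    rwa [Submodule.map_span, ← Set.range_comp, Submodule.map_top, Submodule.range_subtype] at this
  rw [this, hC.sup_eq_top]

/-- A one-dimensional ideal of a perfect Lie algebra is central. -/
lemma lie_eq_zero_of_mem_of_finrank_eq_one {I : LieIdeal K L} (hI : Module.finrank K I = 1)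
    (hL : derivedSeries K L 1 = ⊤) {x : L} (hx : x ∈ I) (y : L) : ⁅x, y⁆ = 0 := by
  obtain ⟨u, -, hu⟩ := finrank_eq_one_iff'.mp hI
  have hscalar (z : L) : ∃ c : K, ⁅z, (u : L)⁆ = c • (u : L) := by
    obtain ⟨c, hc⟩ := hu ⁅z, u⁆
    exact ⟨c, by simpa using (congrArg Subtype.val hc).symm⟩
  have hyu : ⁅(u : L), y⁆ = 0 := by
    have hy : y ∈ (derivedSeries K L 1).toSubmodule := by rw [hL]; exact Submodule.mem_top
    have key := coe_derivedSeries_one_eq K L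
    simp only [LieIdeal.toLieSubalgebra_toSubmodule] at key
    rw [key] at hy
    induction hy using Submodule.span_induction with
    | mem z hz =>
      obtain ⟨a, b, rfl⟩ := hz
      obtain ⟨c, hc⟩ := hscalar a
      obtain ⟨d, hd⟩ := hscalar b
      rw [← lie_skew, lie_lie, hc, hd, lie_smul, lie_smul, hc, hd, smul_smul, smul_smul,
        mul_comm c d, sub_self, neg_zero]
    | zero => exact lie_zero _
    | add a b _ _ ha hb => rw [lie_add, ha, hb, add_zero]
    | smul r a _ ha => rw [lie_smul, ha, smul_zero]
  obtain ⟨c, hc⟩ := hu ⟨x, hx⟩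
  have hxu : x = c • (u : L) := by simpa using (congrArg Subtype.val hc).symm
  rw [hxu, smul_lie, hyu, smul_zero]

/-- Every alternating trilinear form in four variables, given by its coefficients, has a nontrivial
kernel. -/
lemma exists_ne_zero_forall_sum_mul_eq_zero (f : Fin 4 → Fin 4 → Fin 4 → K)
    (hself : ∀ i j, f i i j = 0) (hswap : ∀ i j k, f i k j = -f i j k)
    (hrot : ∀ i j k, f j k i = f i j k) :
    ∃ p : Fin 4 → K, p ≠ 0 ∧ ∀ i j, ∑ k, p k * f k i j = 0 := by
  have hself' (i j : Fin 4) : f i j i = 0 := by rw [hswap, hself, neg_zero]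
  have hdiag (i j : Fin 4) : f i j j = 0 := by rw [← hrot, hself]
  have hswap' (i j k : Fin 4) : f j i k = -f i j k := by rw [← hrot, hswap, hrot, ← hrot, hrot]
  have hexp (i j : Fin 4) (p : Fin 4 → K) : ∑ k, p k * f k i j =
      p 0 * f 0 i j + p 1 * f 1 i j + p 2 * f 2 i j + p 3 * f 3 i j := Fin.sum_univ_four _
  simp only [hexp]
  by_cases hzero : f 1 2 3 = 0 ∧ f 0 2 3 = 0 ∧ f 0 1 3 = 0 ∧ f 0 1 2 = 0
  · obtain ⟨h₀, h₁, h₂, h₃⟩ := hzero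
    refine ⟨![1, 0, 0, 0], fun h ↦ one_ne_zero (congrFun h 0), fun i j ↦ ?_⟩
    simp only [Matrix.cons_val, zero_mul, one_mul, add_zero]
    fin_cases i <;> fin_cases j <;>
      simp only [Fin.zero_eta, Fin.mk_one, Fin.reduceFinMk, hself, hself', hdiag,
        hswap 0 1 2, hswap 0 1 3, hswap 0 2 3, h₁, h₂, h₃, neg_zero]
  · refine ⟨![f 1 2 3, -f 0 2 3, f 0 1 3, -f 0 1 2], fun h ↦ hzero ?_, fun i j ↦ ?_⟩
    · exact ⟨congrFun h 0, neg_eq_zero.mp (congrFun h 1), congrFun h 2,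
        neg_eq_zero.mp (congrFun h 3)⟩
    · simp only [Matrix.cons_val]
      fin_cases i <;> fin_cases j <;>
        simp only [Fin.zero_eta, Fin.mk_one, Fin.reduceFinMk, hself, hself', hdiag,
          hswap 0 1 2, hswap 0 1 3, hswap 0 2 3, hswap 1 0 2, hswap 1 0 3, hswap 1 2 3,
          hswap 2 0 1, hswap 2 0 3, hswap 2 1 3, hswap 3 0 1, hswap 3 0 2, hswap 3 1 2,
          hswap' 0 1 2, hswap' 0 1 3, hswap' 0 2 3, hswap' 1 2 3, (hrot 2 0 1).symm,
          (hrot 3 0 1).symm, (hrot 3 0 2).symm, (hrot 3 1 2).symm] <;> ring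

/-- An invariant symmetric bilinear form on a four-dimensional Lie algebra has a nonzero vector
orthogonal to the derived subalgebra: the alternating trilinear form `Φ x ⁅y, z⁆` has a nontrivial
kernel. -/
lemma exists_ne_zero_derivedSeries_one_le_ker (hL : Module.finrank K L = 4)
    (Φ : LinearMap.BilinForm K L) (hsymm : ∀ x y, Φ x y = Φ y x)
    (hinv : ∀ x y z, Φ ⁅x, y⁆ z = Φ x ⁅y, z⁆) :
    ∃ v ≠ 0, (derivedSeries K L 1).toSubmodule ≤ LinearMap.ker (Φ v) := by
  have : FiniteDimensional K L := Module.finite_of_finrank_pos (by omega)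
  let e := Module.finBasisOfFinrankEq K L hL
  obtain ⟨p, hp, hpf⟩ := exists_ne_zero_forall_sum_mul_eq_zero
    (fun i j k ↦ Φ (e i) ⁅e j, e k⁆)
    (fun i j ↦ by rw [← hinv, lie_self, map_zero, LinearMap.zero_apply])
    (fun i j k ↦ by rw [← lie_skew, map_neg])
    (fun i j k ↦ by rw [← hinv (e j), hsymm])
  refine ⟨∑ k, p k • e k, fun h ↦ hp ?_, ?_⟩
  · exact funext (Fintype.linearIndependent_iff.mp e.linearIndependent p h)
  · refine derivedSeries_one_le_of_sup_span_eq_top (I := ⊥) (v := e) (by simp [e.span_eq])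
      (by simp) fun i j ↦ ?_
    simpa using hpf i j

/-- A perfect Lie algebra of dimension four has a nonzero abelian ideal. -/
lemma exists_isLieAbelian_ne_bot_of_finrank_eq_four [CharZero K] (hL : Module.finrank K L = 4)
    (hperf : derivedSeries K L 1 = ⊤) : ∃ I : LieIdeal K L, IsLieAbelian I ∧ I ≠ ⊥ := by
  have : FiniteDimensional K L := Module.finite_of_finrank_pos (by omega)
  by_contra! h
  have : HasTrivialRadical K L := (hasTrivialRadical_iff_no_abelian_ideals K L).mpr h
  obtain ⟨v, hv, hle⟩ := exists_ne_zero_derivedSeries_one_le_ker hL (killingForm K L)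
    (LieModule.traceForm_comm K L L) (LieModule.traceForm_apply_lie_apply K L L)
  refine hv ?_
  have hmem : v ∈ LinearMap.ker (killingForm K L) := by
    rw [LinearMap.mem_ker]
    ext y
    exact hle (by rw [hperf]; exact Submodule.mem_top)
  simpa using hmem

/-- A four-dimensional Lie algebra with a nonzero abelian ideal is not perfect. -/
lemma derivedSeries_one_ne_top_of_isLieAbelian {I : LieIdeal K L} [IsLieAbelian I]
    (hL : Module.finrank K L = 4) (hI : I ≠ ⊥) :
    derivedSeries K L 1 ≠ ⊤ := by
  intro hperf
  have : FiniteDimensional K L := Module.finite_of_finrank_pos (by omega)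
  have habel (x : L) (hx : x ∈ I) (y : L) (hy : y ∈ I) : ⁅x, y⁆ = 0 := by
    simpa using congrArg Subtype.val (trivial_lie_zero I I ⟨x, hx⟩ ⟨y, hy⟩)
  have hlie (x : L) (hx : x ∈ I) (y : L) : ⁅x, y⁆ ∈ I := lie_mem_left K L I x y hx
  have hpos : 0 < Module.finrank K I.toSubmodule := by
    rw [Module.finrank_pos_iff, Submodule.nontrivial_iff_ne_bot]
    simpa using hI
  have hle : Module.finrank K I.toSubmodule ≤ 4 := hL ▸ I.toSubmodule.finrank_le
  obtain ⟨n, hn⟩ := Nat.exists_eq_add_of_le hle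
  obtain ⟨v, hv⟩ := I.toSubmodule.exists_sup_span_range_eq_top (n := n) (by omega)
  suffices ∃ J : Submodule K L, (∀ x ∈ I, ∀ y : L, ⁅x, y⁆ ∈ J) ∧ (∀ i j, ⁅v i, v j⁆ ∈ J) ∧
      Module.finrank K J < 4 by
    obtain ⟨J, hJ₁, hJ₂, hJ⟩ := this
    have hJtop : J = ⊤ := by
      have hle := derivedSeries_one_le_of_sup_span_eq_top hv hJ₁ hJ₂
      rwa [hperf, LieSubmodule.top_toSubmodule, top_le_iff] at hle
    rw [hJtop, finrank_top, hL] at hJ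
    exact lt_irrefl _ hJ
  have hcases : n = 0 ∨ n = 1 ∨ n = 2 ∨ n = 3 := by omega
  rcases hcases with rfl | rfl | rfl | rfl
  · have htop : I.toSubmodule = ⊤ := Submodule.eq_top_of_finrank_eq (by omega)
    have hmem (y : L) : y ∈ I.toSubmodule := htop ▸ Submodule.mem_top
    exact ⟨⊥, fun x hx y ↦ habel x hx y (hmem y), fun i ↦ i.elim0, by simp⟩
  · refine ⟨I.toSubmodule, hlie, fun i j ↦ ?_, by omega⟩
    rw [Subsingleton.elim i j, lie_self]
    exact zero_mem _
  · refine ⟨I.toSubmodule ⊔ Submodule.span K {⁅v 0, v 1⁆},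
      fun x hx y ↦ Submodule.mem_sup_left (hlie x hx y), fun i j ↦ Submodule.mem_sup_right ?_, ?_⟩
    · have h := Submodule.mem_span_singleton_self (R := K) ⁅v 0, v 1⁆
      have h' := Submodule.neg_mem _ h
      rw [lie_skew] at h'
      fin_cases i <;> fin_cases j <;> simp [h, h']
    · have h₁ := Submodule.finrank_add_le_finrank_add_finrank I.toSubmodule
        (Submodule.span K {⁅v 0, v 1⁆})
      have h₂ := finrank_span_le_card (R := K) ({⁅v 0, v 1⁆} : Set L)
      simp only [Set.toFinset_singleton, Finset.card_singleton] at h₂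
      omega
  · refine ⟨Submodule.span K (Set.range ![⁅v 0, v 1⁆, ⁅v 0, v 2⁆, ⁅v 1, v 2⁆]),
      fun x hx y ↦ ?_, fun i j ↦ ?_, ?_⟩
    · have hI₁ : Module.finrank K I.toSubmodule = 1 := by omega
      rw [lie_eq_zero_of_mem_of_finrank_eq_one hI₁ hperf hx y]
      exact zero_mem _
    · have h (k : Fin 3) := Submodule.subset_span (R := K)
        (Set.mem_range_self (f := ![⁅v 0, v 1⁆, ⁅v 0, v 2⁆, ⁅v 1, v 2⁆]) k)
      have h₀ := h 0
      have h₁ := h 1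
      have h₂ := h 2
      have h₀' := Submodule.neg_mem _ h₀
      have h₁' := Submodule.neg_mem _ h₁
      have h₂' := Submodule.neg_mem _ h₂
      simp only [Matrix.cons_val, lie_skew, SetLike.mem_coe] at h₀ h₁ h₂ h₀' h₁' h₂'
      fin_cases i <;> fin_cases j <;> simp only [Fin.zero_eta, Fin.mk_one, Fin.reduceFinMk,
        lie_self, zero_mem, h₀, h₁, h₂, h₀', h₁', h₂']
    · have := finrank_range_le_card (R := K) ![⁅v 0, v 1⁆, ⁅v 0, v 2⁆, ⁅v 1, v 2⁆]
      rw [Set.finrank, Fintype.card_fin] at this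
      omega

end LieAlgebra

/-- The derived subalgebra `[L, L]` of a 4-dimensional complex Lie algebra
has dimension at most 3. -/
theorem derived_subalgebra_of_four_dim_complex_lie_algebra_le_three
    (L : Type*) [LieRing L] [LieAlgebra ℂ L] [FiniteDimensional ℂ L]
    (hdim : Module.finrank ℂ L = 4) :
    Module.finrank ℂ ↥(LieAlgebra.derivedSeries ℂ L 1) ≤ 3 := by
  by_contra! h
  have hperf : LieAlgebra.derivedSeries ℂ L 1 = ⊤ := by
    rw [← LieSubmodule.toSubmodule_eq_top]
    refine Submodule.eq_top_of_finrank_eq (le_antisymm (Submodule.finrank_le _) ?_)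
    rw [hdim]
    exact h
  obtain ⟨I, hab, hI⟩ := LieAlgebra.exists_isLieAbelian_ne_bot_of_finrank_eq_four hdim hperf
  exact LieAlgebra.derivedSeries_one_ne_top_of_isLieAbelian hdim hI hperf
end

section
/- Every complex Lie algebra L of dimension 4 contains a Lie ideal I of dimension 3 such that the quotient L/I is the 1-dimensional abelian Lie algebra; that is, L is an extension 0 → I → L → ℂ → 0 of ℂ by a 3-dimensional ideal. -/
open Module in
/-- For a unimodular Lie algebra with basis `b 0, b 1, b 2, b 3`, the `2`-forms
`dα = -α ∘ ⁅·, ·⁆` and `dβ` have `dα ∧ dβ = 0`; here `β` is left out, so that the identity is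
one of vectors of `L`. -/
theorem LieAlgebra.wedge_bracket_eq_zero_of_trace_ad_eq_zero
    {K L : Type*} [Field K] [LieRing L] [LieAlgebra K L] (b : Module.Basis (Fin 4) K L)
    (htr : ∀ x : L, LinearMap.trace K L (LieAlgebra.ad K L x) = 0) (α : Dual K L) :
    α ⁅b 2, b 3⁆ • ⁅b 0, b 1⁆ - α ⁅b 1, b 3⁆ • ⁅b 0, b 2⁆ + α ⁅b 1, b 2⁆ • ⁅b 0, b 3⁆
      + α ⁅b 0, b 3⁆ • ⁅b 1, b 2⁆ - α ⁅b 0, b 2⁆ • ⁅b 1, b 3⁆ + α ⁅b 0, b 1⁆ • ⁅b 2, b 3⁆ = 0 := by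
  have trace_eq (x : L) : b.coord 0 ⁅x, b 0⁆ + b.coord 1 ⁅x, b 1⁆ + b.coord 2 ⁅x, b 2⁆
      + b.coord 3 ⁅x, b 3⁆ = 0 := by
    rw [← htr x, LinearMap.trace_eq_matrix_trace K b, Matrix.trace, Fin.sum_univ_four]
    simp [LinearMap.toMatrix_apply]
  have expand (x y : L) : ⁅x, y⁆ = b.coord 0 x • ⁅b 0, y⁆ + b.coord 1 x • ⁅b 1, y⁆
      + b.coord 2 x • ⁅b 2, y⁆ + b.coord 3 x • ⁅b 3, y⁆ := by
    conv_lhs => rw [← b.sum_repr x, Fin.sum_univ_four]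
    simp
  have jacobi (x y z : L) : ⁅⁅x, y⁆, z⁆ + ⁅⁅y, z⁆, x⁆ + ⁅⁅z, x⁆, y⁆ = 0 := by
    rw [← lie_skew ⁅x, y⁆ z, ← lie_skew ⁅y, z⁆ x, ← lie_skew ⁅z, x⁆ y]
    have := lie_jacobi x y z
    linear_combination (norm := module) -this
  have t0 := trace_eq (b 0)
  have t1 := trace_eq (b 1)
  have t2 := trace_eq (b 2)
  have t3 := trace_eq (b 3)
  have j0 := jacobi (b 1) (b 2) (b 3)
  have j1 := jacobi (b 0) (b 2) (b 3)
  have j2 := jacobi (b 0) (b 1) (b 3)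
  have j3 := jacobi (b 0) (b 1) (b 2)
  simp only [expand ⁅_, _⁆] at j0 j1 j2 j3
  simp only [← lie_skew (b 1) (b 0), ← lie_skew (b 2) (b 0), ← lie_skew (b 3) (b 0),
    ← lie_skew (b 2) (b 1), ← lie_skew (b 3) (b 1), ← lie_skew (b 3) (b 2), lie_self, map_neg,
    map_zero] at t0 t1 t2 t3 j0 j1 j2 j3
  have key (a : Fin 4) : b.coord a ⁅b 2, b 3⁆ • ⁅b 0, b 1⁆ - b.coord a ⁅b 1, b 3⁆ • ⁅b 0, b 2⁆
      + b.coord a ⁅b 1, b 2⁆ • ⁅b 0, b 3⁆ + b.coord a ⁅b 0, b 3⁆ • ⁅b 1, b 2⁆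
      - b.coord a ⁅b 0, b 2⁆ • ⁅b 1, b 3⁆ + b.coord a ⁅b 0, b 1⁆ • ⁅b 2, b 3⁆ = 0 := by
    fin_cases a <;> simp only [Fin.zero_eta, Fin.mk_one, Fin.reduceFinMk]
    · linear_combination (norm := module) j0 - t1 • ⁅b 2, b 3⁆ + t2 • ⁅b 1, b 3⁆ - t3 • ⁅b 1, b 2⁆
    · linear_combination (norm := module) -j1 + t0 • ⁅b 2, b 3⁆ - t2 • ⁅b 0, b 3⁆ + t3 • ⁅b 0, b 2⁆
    · linear_combination (norm := module) j2 - t0 • ⁅b 1, b 3⁆ + t1 • ⁅b 0, b 3⁆ - t3 • ⁅b 0, b 1⁆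
    · linear_combination (norm := module) -j3 + t0 • ⁅b 1, b 2⁆ - t1 • ⁅b 0, b 2⁆ + t2 • ⁅b 0, b 1⁆
  have hα (x : L) : α x = ∑ a, α (b a) * b.coord a x := by
    conv_lhs => rw [← b.sum_repr x, map_sum]
    simp [mul_comm]
  simp only [hα ⁅_, _⁆, Fin.sum_univ_four]
  linear_combination (norm := module) α (b 0) • key 0 + α (b 1) • key 1 + α (b 2) • key 2
    + α (b 3) • key 3

open Module in
/-- A Lie algebra of dimension four over a field is not perfect. -/
theorem LieAlgebra.exists_dual_ne_zero_forall_lie_eq_zero_of_finrank_eq_four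
    {K L : Type*} [Field K] [LieRing L] [LieAlgebra K L] (hdim : finrank K L = 4) :
    ∃ φ : Dual K L, φ ≠ 0 ∧ ∀ x y : L, φ ⁅x, y⁆ = 0 := by
  by_contra! h
  replace h (φ : Dual K L) (hφ : ∀ x y : L, φ ⁅x, y⁆ = 0) : φ = 0 := by
    by_contra hne
    obtain ⟨x, y, hxy⟩ := h φ hne
    exact hxy (hφ x y)
  have : FiniteDimensional K L := .of_finrank_pos (by lia)
  let b : Module.Basis (Fin 4) K L := finBasisOfFinrankEq K L hdim
  have htr (x : L) : LinearMap.trace K L (ad K L x) = 0 := by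
    refine LinearMap.congr_fun (h (LinearMap.trace K L ∘ₗ (ad K L : L →ₗ[K] End K L)) ?_) x
    intro x y
    simp
  have vanish (φ : Dual K L) (h01 : φ ⁅b 0, b 1⁆ = 0) (h02 : φ ⁅b 0, b 2⁆ = 0)
      (h03 : φ ⁅b 0, b 3⁆ = 0) (h12 : φ ⁅b 1, b 2⁆ = 0) (h13 : φ ⁅b 1, b 3⁆ = 0)
      (h23 : φ ⁅b 2, b 3⁆ = 0) : φ = 0 := by
    refine h φ fun x y ↦ ?_
    rw [← b.sum_repr x, ← b.sum_repr y, Fin.sum_univ_four,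
      Fin.sum_univ_four]
    simp only [add_lie, lie_add, smul_lie, lie_smul, lie_self, map_add, map_smul, map_zero,
      ← lie_skew (b 1) (b 0), ← lie_skew (b 2) (b 0), ← lie_skew (b 3) (b 0),
      ← lie_skew (b 2) (b 1), ← lie_skew (b 3) (b 1), ← lie_skew (b 3) (b 2), map_neg,
      h01, h02, h03, h12, h13, h23, neg_zero, smul_zero, add_zero]
  let f : (Fin 6 → K) →ₗ[K] L := Fintype.linearCombination K
    ![⁅b 0, b 1⁆, ⁅b 0, b 2⁆, ⁅b 0, b 3⁆, ⁅b 1, b 2⁆, ⁅b 1, b 3⁆, ⁅b 2, b 3⁆]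
  let g : Dual K L →ₗ[K] (Fin 6 → K) := LinearMap.pi
    ![Dual.eval K L ⁅b 2, b 3⁆, -Dual.eval K L ⁅b 1, b 3⁆, Dual.eval K L ⁅b 1, b 2⁆,
      Dual.eval K L ⁅b 0, b 3⁆, -Dual.eval K L ⁅b 0, b 2⁆, Dual.eval K L ⁅b 0, b 1⁆]
  have hf : LinearMap.range f = ⊤ := by
    by_contra hne
    obtain ⟨φ, hφ, hle⟩ := Submodule.exists_le_ker_of_lt_top _ (lt_top_iff_ne_top.2 hne)
    have hφf (i : Fin 6) : φ (f (Pi.single i 1)) = 0 := hle (LinearMap.mem_range_self f _)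
    simp only [f, Fintype.linearCombination_apply_single, one_smul] at hφf
    exact hφ (vanish φ (hφf 0) (hφf 1) (hφf 2) (hφf 3) (hφf 4) (hφf 5))
  have hg : Function.Injective g := by
    refine (injective_iff_map_eq_zero g).2 fun φ hφ ↦ ?_
    have hφg (i : Fin 6) : g φ i = 0 := congrFun hφ i
    exact vanish φ (hφg 5) (neg_eq_zero.1 (hφg 4)) (hφg 3) (hφg 2) (neg_eq_zero.1 (hφg 1)) (hφg 0)
  have hfg : LinearMap.range g ≤ LinearMap.ker f := by
    rintro _ ⟨α, rfl⟩
    have := wedge_bracket_eq_zero_of_trace_ad_eq_zero b htr α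
    simp only [LinearMap.mem_ker, f, g, Fintype.linearCombination_apply, Fin.sum_univ_six]
    simpa [sub_eq_add_neg] using this
  have h1 := Submodule.finrank_mono hfg
  have h2 := f.finrank_range_add_finrank_ker
  rw [LinearMap.finrank_range_of_inj hg, Subspace.dual_finrank_eq, hdim] at h1
  rw [hf, finrank_top, hdim, finrank_fin_fun] at h2
  lia

/-- Every 4-dimensional complex Lie algebra `L` contains a 3-dimensional
Lie ideal `I` such that the quotient `L ⧸ I` is the 1-dimensional abelian Lie algebra,
i.e. `L` is an extension `0 → I → L → ℂ → 0`. -/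
theorem four_dim_complex_lie_algebra_has_codim_one_ideal
    (L : Type*) [LieRing L] [LieAlgebra ℂ L] [FiniteDimensional ℂ L]
    (hdim : Module.finrank ℂ L = 4) :
    ∃ I : LieIdeal ℂ L, Module.finrank ℂ ↥I = 3 ∧
      Module.finrank ℂ (L ⧸ I) = 1 ∧ IsLieAbelian (L ⧸ I) := by
  obtain ⟨φ, hφ, hlie⟩ :=
    LieAlgebra.exists_dual_ne_zero_forall_lie_eq_zero_of_finrank_eq_four hdim
  let I : LieIdeal ℂ L := { LinearMap.ker φ with lie_mem := fun {x y} _ ↦ hlie x y }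
  have hI : Module.finrank ℂ I + 1 = 4 := by
    rw [← hdim]
    exact Module.Dual.finrank_ker_add_one_of_ne_zero hφ
  have hQ : Module.finrank ℂ (L ⧸ I) + Module.finrank ℂ I = 4 := by
    rw [← hdim]
    exact Submodule.finrank_quotient_add_finrank I.toSubmodule
  refine ⟨I, by lia, by lia, ⟨fun x y ↦ ?_⟩⟩
  obtain ⟨x, rfl⟩ := LieSubmodule.Quotient.surjective_mk' I x
  obtain ⟨y, rfl⟩ := LieSubmodule.Quotient.surjective_mk' I y
  exact (LieSubmodule.Quotient.mk_eq_zero' (N := I) (m := ⁅x, y⁆)).2 (hlie x y)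
end
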